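/- Let D = (μ, η) be a data distribution over ℝ^d × {±1} with η continuous, fix 0 < κ < 1, and define U_x to be the closure of the partial neighborhood preserving robustness region V_x^κ. Then the collection {U_x} satisfies: (1) U_x is closed for all x; (2) if x ∈ D⁺ then for all x' ∈ U_x, ρ(x, x') < ρ(D⁻ ∪ D_{1/2}, x'); (3) if x ∈ D⁻ then for all x' ∈ U_x, ρ(x, x') < ρ(D⁺ ∪ D_{1/2}, x'); (4) U_x = {x} for all x ∈ D_{1/2}; and (5) U_x is bounded for all x. -/

import Mathlib

open MeasureTheory Metric Set Filter Topology
open scoped ENNReal Classical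

noncomputable section

/-- The real value of a `Bool` label: `true ↦ +1`, `false ↦ -1`. -/
def labelVal (b : Bool) : ℝ := if b then 1 else -1

abbrev Eucl (d : ℕ) : Type := EuclideanSpace ℝ (Fin d)

section BasicDefs

variable {E : Type*} [MeasurableSpace E]

/-- The joint distribution on instance-label pairs determined by the marginal `μ`
and the regression function `η` (label `+1` with probability `η x`). -/
def jointD (μ : Measure E) (η : E → ℝ) : Measure (E × Bool) :=
  μ.bind fun x =>
    ENNReal.ofReal (η x) • Measure.dirac (x, true) +
      ENNReal.ofReal (1 - η x) • Measure.dirac (x, false)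

/-- The distribution of an i.i.d. sample of size `n` from `D = (μ, η)`. -/
def sampleD (μ : Measure E) (η : E → ℝ) (n : ℕ) : Measure (Fin n → E × Bool) :=
  Measure.pi fun _ => jointD μ η

/-- The accuracy `A(f, D) = P_{(x,y) ∼ D}[f x = y]`. -/
def accuracy (μ : Measure E) (η : E → ℝ) (f : E → Bool) : ℝ :=
  (jointD μ η {p | f p.1 = p.2}).toReal

/-- The astuteness `A_U(f, D) = P_{(x,y) ∼ D}[f x' = y for all x' ∈ U x]`. -/
def astuteness (μ : Measure E) (η : E → ℝ) (U : E → Set E) (f : E → Bool) : ℝ :=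
  (jointD μ η {p | ∀ x' ∈ U p.1, f x' = p.2}).toReal

/-- The Bayes optimal classifier: `+1` iff `η x ≥ 1/2`. -/
def bayes (η : E → ℝ) : E → Bool := fun x => if (1/2 : ℝ) ≤ η x then true else false

end BasicDefs

section MetricDefs

variable {E : Type*} [MetricSpace E]

/-- The neighborhood preserving Bayes optimal classifier:
`+1` at `x` iff `ρ(x, μ⁺) ≤ ρ(x, μ⁻)`. -/
def gNeighbor (η : E → ℝ) : E → Bool := fun x =>
  if infDist x {z | (1/2 : ℝ) < η z} ≤ infDist x {z | η z < (1/2 : ℝ)} then true else false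

/-- The neighborhood preserving robustness region `V_x`. -/
def nbhdRegion (η : E → ℝ) (x : E) : Set E :=
  if (1/2 : ℝ) < η x then {x' | dist x x' < infDist x' {z | η z ≤ (1/2 : ℝ)}}
  else if η x < (1/2 : ℝ) then {x' | dist x x' < infDist x' {z | (1/2 : ℝ) ≤ η z}}
  else {x}

/-- The partial neighborhood preserving robustness region `V_x^κ`. -/
def nbhdRegionK (η : E → ℝ) (κ : ℝ) (x : E) : Set E :=
  if (1/2 : ℝ) < η x then {x' | dist x x' < κ * infDist x' {z | η z ≤ (1/2 : ℝ)}}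
  else if η x < (1/2 : ℝ) then {x' | dist x x' < κ * infDist x' {z | (1/2 : ℝ) ≤ η z}}
  else {x}

variable [MeasurableSpace E]

/-- The support of a measure: all points whose balls all have positive mass. -/
def msupport (μ : Measure E) : Set E := {x | ∀ r > 0, 0 < μ (Metric.ball x r)}

/-- `D⁺`: points of the support where `η > 1/2`. -/
def Dplus (μ : Measure E) (η : E → ℝ) : Set E := {x | x ∈ msupport μ ∧ (1/2 : ℝ) < η x}

/-- `D⁻`: points of the support where `η < 1/2`. -/
def Dminus (μ : Measure E) (η : E → ℝ) : Set E := {x | x ∈ msupport μ ∧ η x < (1/2 : ℝ)}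

/-- `D_{1/2}`: points of the support where `η = 1/2`. -/
def Dhalf (μ : Measure E) (η : E → ℝ) : Set E := {x | x ∈ msupport μ ∧ η x = (1/2 : ℝ)}

/-- The partial neighborhood preserving robustness region `V_x^κ`, support version. -/
def nbhdRegionKSupp (μ : Measure E) (η : E → ℝ) (κ : ℝ) (x : E) : Set E :=
  if x ∈ Dplus μ η then {x' | dist x x' < κ * infDist x' (Dminus μ η ∪ Dhalf μ η)}
  else if x ∈ Dminus μ η then {x' | dist x x' < κ * infDist x' (Dplus μ η ∪ Dhalf μ η)}
  else {x}

/-- The probability radius `r_p(x) = inf {r : μ(B(x,r)) ≥ p}`. -/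
def probRadius (μ : Measure E) (p : ℝ) (x : E) : ℝ :=
  sInf {r : ℝ | ENNReal.ofReal p ≤ μ (closedBall x r)}

/-- `r_p^ε(x) = sup {r : μ(B(x,r)) − μ(B(x,r_p(x))) ≤ ε}`. -/
def probRadiusEps (μ : Measure E) (p ε : ℝ) (x : E) : ℝ :=
  sSup {r : ℝ | (μ (closedBall x r)).toReal - (μ (closedBall x (probRadius μ p x))).toReal ≤ ε}

/-- `x` is `(p, Δ)`-covered: for all `x' ∈ U x` and all
`x'' ∈ B(x', r_p(x')) ∩ supp(μ)`, `η x'' > 1/2 + Δ`. -/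
def Covered (μ : Measure E) (η : E → ℝ) (U : E → Set E) (p Δ : ℝ) (x : E) : Prop :=
  ∀ x' ∈ U x, ∀ x'' ∈ closedBall x' (probRadius μ p x') ∩ msupport μ, 1/2 + Δ < η x''

end MetricDefs

/-- A weight function: for each sample of instances it produces nonnegative
weights summing to one, depending only on the instances. -/
structure WeightFn (E : Type*) where
  w : (n : ℕ) → (Fin n → E) → Fin n → E → ℝ
  nonneg : ∀ n xs i x, 0 ≤ w n xs i x
  le_one : ∀ n xs i x, w n xs i x ≤ 1
  sum_one : ∀ (n : ℕ) (xs : Fin n → E) (x : E), 0 < n → ∑ i, w n xs i x = 1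

/-- The classifier learned by a weight function from the sample `S`:
`+1` iff `∑ i, w_i(x) y_i > 0`. -/
def WeightFn.classify {E : Type*} (W : WeightFn E) {n : ℕ} (S : Fin n → E × Bool) : E → Bool :=
  fun x => if 0 < ∑ i, W.w n (fun j => (S j).1) i x * labelVal (S i).2 then true else false

/-- The splitting number of a family of weights on a fixed sample: the number of
distinct sets `{i : ρ(x, x_i) ≤ α, w_i(x) ≥ β}`. -/
def splitNumRaw {E : Type*} [MetricSpace E] {n : ℕ} (xs : Fin n → E) (w : Fin n → E → ℝ) : ℕ :=
  Set.ncard {T : Set (Fin n) | ∃ (x : E) (α β : ℝ), 0 ≤ α ∧ β ∈ Icc (0:ℝ) 1 ∧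
    T = {i | dist x (xs i) ≤ α ∧ β ≤ w i x}}

/-- The splitting number `T(W, S)` of a weight function. -/
def WeightFn.splitNum {E : Type*} [MetricSpace E] (W : WeightFn E) {n : ℕ}
    (xs : Fin n → E) : ℕ :=
  splitNumRaw xs (W.w n xs)

/-- Consistency with respect to accuracy: the accuracy of the learned classifier
converges in probability to the accuracy of the Bayes optimal classifier. -/
def ConsistentAcc {E : Type*} [MeasurableSpace E] (W : WeightFn E)
    (μ : Measure E) (η : E → ℝ) : Prop :=
  ∀ ε > (0:ℝ), ∀ δ > (0:ℝ), ∃ N : ℕ, ∀ n ≥ N,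
    ENNReal.ofReal (1 - δ) ≤
      sampleD μ η n {S | accuracy μ η (bayes η) - ε ≤ accuracy μ η (W.classify S)}

/-- Neighborhood consistency: for all `0 < ε, δ, κ < 1`, eventually with probability
at least `1 - δ` the astuteness w.r.t. `V^κ` is at least `A(g, D) - ε`. -/
def NbhdConsistent {E : Type*} [MetricSpace E] [MeasurableSpace E] (W : WeightFn E)
    (μ : Measure E) (η : E → ℝ) : Prop :=
  ∀ ε ∈ Ioo (0:ℝ) 1, ∀ δ ∈ Ioo (0:ℝ) 1, ∀ κ ∈ Ioo (0:ℝ) 1, ∃ N : ℕ, ∀ n ≥ N,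
    ENNReal.ofReal (1 - δ) ≤
      sampleD μ η n {S | accuracy μ η (bayes η) - ε ≤
        astuteness μ η (nbhdRegionK η κ) (W.classify S)}

/-- Condition 2 of the main theorem: vanishing expected supremal weight outside
the probability-radius balls. -/
def Cond2 {E : Type*} [MetricSpace E] [MeasurableSpace E] (W : WeightFn E)
    (μ : Measure E) (η : E → ℝ) : Prop :=
  ∀ p ∈ Ioo (0:ℝ) 1,
    Tendsto (fun n => ∫ S, (⨆ x : E, ∑ i, W.w n (fun j => (S j).1) i x *
      (if probRadius μ p x < dist x ((S i).1) then (1:ℝ) else 0)) ∂ sampleD μ η n)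
      atTop (nhds 0)

/-- Condition 3 of the main theorem: `E[t_n · sup_x max_i w_i(x)] → 0`. -/
def Cond3 {E : Type*} [MetricSpace E] [MeasurableSpace E] (W : WeightFn E)
    (μ : Measure E) (η : E → ℝ) (t : ℕ → ℕ) : Prop :=
  Tendsto (fun n => ∫ S, (t n : ℝ) *
    (⨆ x : E, ⨆ i, W.w n (fun j => (S j).1) i x) ∂ sampleD μ η n) atTop (nhds 0)

/-- Condition 4 of the main theorem: `E[log T(W,S) / t_n] → 0`. -/
def Cond4 {E : Type*} [MetricSpace E] [MeasurableSpace E] (W : WeightFn E)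
    (μ : Measure E) (η : E → ℝ) (t : ℕ → ℕ) : Prop :=
  Tendsto (fun n => ∫ S, Real.log (W.splitNum (fun j => (S j).1)) / (t n : ℝ)
    ∂ sampleD μ η n) atTop (nhds 0)

/-- `f` is a `k`-nearest neighbor classifier for the labelled sample `(xs, ys)`:
at every query point it takes a majority vote over some set of `k` nearest points. -/
def IsKNNClassifier {E : Type*} [MetricSpace E] {n : ℕ} (k : ℕ)
    (xs : Fin n → E) (ys : Fin n → Bool) (f : E → Bool) : Prop :=
  ∀ x : E, ∃ T : Finset (Fin n), T.card = min k n ∧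
    (∀ i ∈ T, ∀ j ∉ T, dist x (xs i) ≤ dist x (xs j)) ∧
    (f x = true ↔ 0 < ∑ i ∈ T, labelVal (ys i))

/-- `W` is the weight function of the `k_n`-nearest neighbor classifier. -/
def IsKNNWeightSeq {E : Type*} [MetricSpace E] (k : ℕ → ℕ) (W : WeightFn E) : Prop :=
  ∀ (n : ℕ) (xs : Fin n → E) (x : E), ∃ T : Finset (Fin n), T.card = min (k n) n ∧
    (∀ i ∈ T, ∀ j ∉ T, dist x (xs i) ≤ dist x (xs j)) ∧
    ∀ i, W.w n xs i x = if i ∈ T then ((min (k n) n : ℝ))⁻¹ else 0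

/-- `w` is the weight family of the `k`-nearest neighbor rule on the sample `xs`
with ties in distance broken by smaller value of `z`. -/
def IsKNNTieWeight {E : Type*} [MetricSpace E] {n : ℕ} (k : ℕ) (xs : Fin n → E)
    (z : Fin n → ℝ) (w : Fin n → E → ℝ) : Prop :=
  ∀ x : E, ∃ T : Finset (Fin n), T.card = min k n ∧
    (∀ i ∈ T, ∀ j ∉ T,
      dist x (xs i) < dist x (xs j) ∨ (dist x (xs i) = dist x (xs j) ∧ z i ≤ z j)) ∧
    ∀ i, w i x = if i ∈ T then ((min k n : ℝ))⁻¹ else 0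

/-- The kernel weights `w_i(x) = K(ρ(x,x_i)/h) / ∑_j K(ρ(x,x_j)/h)`. -/
def kernelW (K : ℝ → ℝ) (h : ℝ) {E : Type*} [MetricSpace E] {n : ℕ}
    (xs : Fin n → E) (i : Fin n) (x : E) : ℝ :=
  K (dist x (xs i) / h) / ∑ j, K (dist x (xs j) / h)

/-- The kernel classifier: `+1` iff `∑_i K(ρ(x,x_i)/h) y_i > 0`. -/
def kernelClassify (K : ℝ → ℝ) (h : ℝ) {E : Type*} [MetricSpace E] {n : ℕ}
    (S : Fin n → E × Bool) : E → Bool :=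
  fun x => if 0 < ∑ i, K (dist x ((S i).1) / h) * labelVal (S i).2 then true else false

end

section Statements

open MeasureTheory Metric Set Filter Topology
open scoped ENNReal Classical

/-- The points closer to `x` than `κ` times their distance to `B`. -/
def relBall {E : Type*} [MetricSpace E] (κ : ℝ) (B : Set E) (x : E) : Set E :=
  {x' | dist x x' < κ * infDist x' B}

lemma dist_le_of_mem_closure_relBall {E : Type*} [MetricSpace E] {κ : ℝ} {B : Set E} {x x' : E}
    (h : x' ∈ closure (relBall κ B x)) : dist x x' ≤ κ * infDist x' B :=
  closure_minimal (s := relBall κ B x) (t := {y | dist x y ≤ κ * infDist y B})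
    (fun _ hy => le_of_lt (show dist x _ < κ * infDist _ B from hy))
    (isClosed_le (by fun_prop) (continuous_const.mul (continuous_infDist_pt B))) h

lemma relBall_empty {E : Type*} [MetricSpace E] (κ : ℝ) (x : E) : relBall κ ∅ x = ∅ := by
  ext y
  simp [relBall]

lemma dist_lt_infDist_of_mem_closure_relBall {E : Type*} [MetricSpace E] {κ : ℝ} (hκ : κ < 1)
    {B : Set E} {x x' : E} (hx : x ∉ closure B) (h : x' ∈ closure (relBall κ B x)) :
    dist x x' < infDist x' B := by
  rcases B.eq_empty_or_nonempty with rfl | hB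
  · simp [relBall_empty] at h
  have hle := dist_le_of_mem_closure_relBall h
  rcases (infDist_nonneg (x := x') (s := B)).eq_or_lt with h0 | h0
  · rw [← h0, mul_zero] at hle
    obtain rfl := dist_le_zero.mp hle
    exact absurd ((mem_closure_iff_infDist_zero hB).mpr h0.symm) hx
  · exact hle.trans_lt (mul_lt_of_lt_one_left h0 hκ)

lemma isBounded_relBall {E : Type*} [MetricSpace E] {κ : ℝ} (hκ : κ ∈ Ioo (0 : ℝ) 1)
    (B : Set E) (x : E) : Bornology.IsBounded (relBall κ B x) := by
  refine isBounded_closedBall.subset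
    (show relBall κ B x ⊆ closedBall x (κ * infDist x B / (1 - κ)) from fun y hy => ?_)
  have h1 : dist x y < κ * infDist y B := hy
  have h2 : infDist y B ≤ infDist x B + dist y x := infDist_le_infDist_add_dist
  rw [mem_closedBall, le_div_iff₀ (by linarith [hκ.2])]
  rw [dist_comm] at h1
  nlinarith [mul_le_mul_of_nonneg_left h2 hκ.1.le]

lemma notMem_Dplus_of_le {E : Type*} [MetricSpace E] [MeasurableSpace E] {μ : Measure E}
    {η : E → ℝ} {x : E} (h : η x ≤ 1 / 2) : x ∉ Dplus μ η := fun hx => hx.2.not_ge h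

lemma notMem_Dminus_of_le {E : Type*} [MetricSpace E] [MeasurableSpace E] {μ : Measure E}
    {η : E → ℝ} {x : E} (h : 1 / 2 ≤ η x) : x ∉ Dminus μ η := fun hx => hx.2.not_ge h

lemma notMem_closure_of_mem_Dplus {E : Type*} [MetricSpace E] [MeasurableSpace E]
    {μ : Measure E} {η : E → ℝ} (hη : Continuous η) {x : E} (hx : x ∈ Dplus μ η) :
    x ∉ closure (Dminus μ η ∪ Dhalf μ η) := fun h =>
  hx.2.not_ge <| closure_minimal (t := {z | η z ≤ 1 / 2})
    (union_subset (fun _ hz => hz.2.le) (fun _ hz => hz.2.le))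
    (isClosed_le hη continuous_const) h

lemma notMem_closure_of_mem_Dminus {E : Type*} [MetricSpace E] [MeasurableSpace E]
    {μ : Measure E} {η : E → ℝ} (hη : Continuous η) {x : E} (hx : x ∈ Dminus μ η) :
    x ∉ closure (Dplus μ η ∪ Dhalf μ η) := fun h =>
  hx.2.not_ge <| closure_minimal (t := {z | 1 / 2 ≤ η z})
    (union_subset (fun _ hz => hz.2.le) (fun _ hz => hz.2.ge))
    (isClosed_le continuous_const hη) h

lemma nbhdRegionKSupp_of_mem_Dplus {E : Type*} [MetricSpace E] [MeasurableSpace E]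
    {μ : Measure E} {η : E → ℝ} {κ : ℝ} {x : E} (hx : x ∈ Dplus μ η) :
    nbhdRegionKSupp μ η κ x = relBall κ (Dminus μ η ∪ Dhalf μ η) x := if_pos hx

lemma nbhdRegionKSupp_of_mem_Dminus {E : Type*} [MetricSpace E] [MeasurableSpace E]
    {μ : Measure E} {η : E → ℝ} {κ : ℝ} {x : E} (hx : x ∈ Dminus μ η) :
    nbhdRegionKSupp μ η κ x = relBall κ (Dplus μ η ∪ Dhalf μ η) x :=
  (if_neg (notMem_Dplus_of_le hx.2.le)).trans (if_pos hx)

lemma nbhdRegionKSupp_of_notMem {E : Type*} [MetricSpace E] [MeasurableSpace E]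
    {μ : Measure E} {η : E → ℝ} {κ : ℝ} {x : E} (hp : x ∉ Dplus μ η) (hm : x ∉ Dminus μ η) :
    nbhdRegionKSupp μ η κ x = {x} := (if_neg hp).trans (if_neg hm)

/-- properties of the closures `U_x` of the partial neighborhood
preserving regions `V_x^κ`. -/
theorem stmt7 {d : ℕ} (μ : Measure (Eucl d)) (η : Eucl d → ℝ) (hηc : Continuous η)
    (κ : ℝ) (hκ : κ ∈ Ioo (0:ℝ) 1) :
    (∀ x : Eucl d, IsClosed (closure (nbhdRegionKSupp μ η κ x))) ∧
    (∀ x ∈ Dplus μ η, ∀ x' ∈ closure (nbhdRegionKSupp μ η κ x),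
      dist x x' < infDist x' (Dminus μ η ∪ Dhalf μ η)) ∧
    (∀ x ∈ Dminus μ η, ∀ x' ∈ closure (nbhdRegionKSupp μ η κ x),
      dist x x' < infDist x' (Dplus μ η ∪ Dhalf μ η)) ∧
    (∀ x ∈ Dhalf μ η, closure (nbhdRegionKSupp μ η κ x) = {x}) ∧
    (∀ x : Eucl d, Bornology.IsBounded (closure (nbhdRegionKSupp μ η κ x))) := by
  refine ⟨fun x => isClosed_closure, fun x hx x' hx' => ?_, fun x hx x' hx' => ?_,
    fun x hx => ?_, fun x => Bornology.IsBounded.closure ?_⟩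
  · rw [nbhdRegionKSupp_of_mem_Dplus hx] at hx'
    exact dist_lt_infDist_of_mem_closure_relBall hκ.2 (notMem_closure_of_mem_Dplus hηc hx) hx'
  · rw [nbhdRegionKSupp_of_mem_Dminus hx] at hx'
    exact dist_lt_infDist_of_mem_closure_relBall hκ.2 (notMem_closure_of_mem_Dminus hηc hx) hx'
  · rw [nbhdRegionKSupp_of_notMem (notMem_Dplus_of_le hx.2.le) (notMem_Dminus_of_le hx.2.ge),
      closure_singleton]
  · by_cases hp : x ∈ Dplus μ η
    · rw [nbhdRegionKSupp_of_mem_Dplus hp]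
      exact isBounded_relBall hκ _ x
    by_cases hm : x ∈ Dminus μ η
    · rw [nbhdRegionKSupp_of_mem_Dminus hm]
      exact isBounded_relBall hκ _ x
    rw [nbhdRegionKSupp_of_notMem hp hm]
    exact Bornology.isBounded_singleton

end Statements
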